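/- Let g be a 4-dimensional unimodular real Lie algebra and let (J, R, σ) be a generalized complex structure on g of type 1. Then there exist a basis (e₁, e₂, e₃, e₄) of g and λ in ℝ such that: J e₁ = λ e₁, J e₂ = λ e₂, J e₃ = e₄, J e₄ = -e₃; R(α) = α(e₁) e₂ - α(e₂) e₁ for all α in g*; σ(u)(v) = (1 + λ²)(e¹(u) e²(v) - e²(u) e¹(v)) for all u, v, where (e¹, e², e³, e⁴) is the dual basis; and the Lie brackets of the basis vectors, with all brackets not listed (and not determined by antisymmetry) equal to zero, have one of the following forms: (U1) there exist y, q₁, q₂ in ℝ with [e₁,e₂] = e₁, [e₂,e₃] = (1/2)e₃ - y e₄ - q₁ e₁, [e₂,e₄] = y e₃ + (1/2)e₄ - q₂ e₁; (U2) there exist b₁, b₂, y, q₁, q₂ in ℝ with [e₃,e₄] = b₁ e₁ + b₂ e₂, [e₂,e₃] = -y e₄ - q₁ e₁, [e₂,e₄] = y e₃ - q₂ e₁; (U3) there exist b₁, b₂, p, q, r in ℝ with |p² + q r| equal to 0 or 1 and [e₃,e₄] = b₁ e₁ + b₂ e₂, [e₄,e₁] = p e₁ + r e₂, [e₄,e₂]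 = q e₁ - p e₂. -/

import Mathlib

open Module LinearMap

variable {g : Type*} [LieRing g] [LieAlgebra ℝ g]

/-- The coadjoint action: `(coad u α) v = -α ⁅u, v⁆`. -/
noncomputable def coad (u : g) (α : Module.Dual ℝ g) : Module.Dual ℝ g :=
  -(α ∘ₗ (LieAlgebra.ad ℝ g u : g →ₗ[ℝ] g))

/-- The bracket `⁅u + α, v + β⁆▷ = ⁅u, v⁆ + ad*_u β - ad*_v α` on `g ⊕ g*`. -/
noncomputable def dbracket (a b : g × Module.Dual ℝ g) : g × Module.Dual ℝ g :=
  (⁅a.1, b.1⁆, coad a.1 b.2 - coad b.1 a.2)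

/-- The neutral pairing `⟨u + α, v + β⟩ = (α v + β u)/2` on `g ⊕ g*`. -/
noncomputable def pairing (a b : g × Module.Dual ℝ g) : ℝ :=
  (a.2 b.1 + b.2 a.1) / 2

/-- `dτ(u,v,w) = -τ(⁅u,v⁆,w) + τ(⁅u,w⁆,v) - τ(⁅v,w⁆,u)`. -/
noncomputable def dForm (τ : g → g → ℝ) (u v w : g) : ℝ :=
  -τ ⁅u, v⁆ w + τ ⁅u, w⁆ v - τ ⁅v, w⁆ u

/-- The linear functional `w ↦ dσ^b(u,v,w)`. -/
noncomputable def dSigma (σ : g →ₗ[ℝ] Module.Dual ℝ g) (u v : g) : Module.Dual ℝ g :=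
  -σ ⁅u, v⁆ + (σ.flip v) ∘ₗ (LieAlgebra.ad ℝ g u : g →ₗ[ℝ] g)
    - (σ.flip u) ∘ₗ (LieAlgebra.ad ℝ g v : g →ₗ[ℝ] g)

/-- A generalized complex structure on a Lie algebra `g`. -/
structure IsGCS (J : g →ₗ[ℝ] g) (R : Module.Dual ℝ g →ₗ[ℝ] g)
    (σ : g →ₗ[ℝ] Module.Dual ℝ g) : Prop where
  skewR : ∀ α β : Module.Dual ℝ g, α (R β) = -β (R α)
  skewσ : ∀ u v : g, σ u v = -σ v u
  c0a : J ∘ₗ J + R ∘ₗ σ = -LinearMap.id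
  c0b : J ∘ₗ R = R ∘ₗ J.dualMap
  c0c : σ ∘ₗ J = J.dualMap ∘ₗ σ
  c1 : ∀ α β γ : Module.Dual ℝ g, α ⁅R β, R γ⁆ + β ⁅R γ, R α⁆ + γ ⁅R α, R β⁆ = 0
  c2 : ∀ α β : Module.Dual ℝ g,
    J.dualMap (coad (R α) β - coad (R β) α)
      = coad (R α) (J.dualMap β) - coad (R β) (J.dualMap α)
  c3 : ∀ u v : g, ⁅J u, J v⁆ - J ⁅J u, v⁆ - J ⁅u, J v⁆ + J (J ⁅u, v⁆) = R (dSigma σ u v)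
  c4 : ∀ u v w : g, dForm (fun a b => σ (J a) b) u v w =
    dForm (fun a b => σ a b) (J u) v w + dForm (fun a b => σ a b) u (J v) w +
      dForm (fun a b => σ a b) u v (J w)

/-- The endomorphism of `g ⊕ g*` associated to a triple `(J, R, σ)`. -/
noncomputable def Kmap (J : g →ₗ[ℝ] g) (R : Module.Dual ℝ g →ₗ[ℝ] g)
    (σ : g →ₗ[ℝ] Module.Dual ℝ g) (a : g × Module.Dual ℝ g) : g × Module.Dual ℝ g :=
  (J a.1 + R a.2, σ a.1 - J.dualMap a.2)

/-- A generalized Kähler structure on a Lie algebra `g`. -/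
structure IsGK (J₁ : g →ₗ[ℝ] g) (R₁ : Module.Dual ℝ g →ₗ[ℝ] g)
    (σ₁ : g →ₗ[ℝ] Module.Dual ℝ g) (J₂ : g →ₗ[ℝ] g) (R₂ : Module.Dual ℝ g →ₗ[ℝ] g)
    (σ₂ : g →ₗ[ℝ] Module.Dual ℝ g) : Prop where
  gcs₁ : IsGCS J₁ R₁ σ₁
  gcs₂ : IsGCS J₂ R₂ σ₂
  comm : ∀ x : g × Module.Dual ℝ g,
    Kmap J₁ R₁ σ₁ (Kmap J₂ R₂ σ₂ x) = Kmap J₂ R₂ σ₂ (Kmap J₁ R₁ σ₁ x)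
  symm : ∀ x y : g × Module.Dual ℝ g,
    pairing (Kmap J₁ R₁ σ₁ (Kmap J₂ R₂ σ₂ x)) y = pairing (Kmap J₁ R₁ σ₁ (Kmap J₂ R₂ σ₂ y)) x
  posdef : ∀ x : g × Module.Dual ℝ g, x ≠ 0 → 0 < pairing (Kmap J₁ R₁ σ₁ (Kmap J₂ R₂ σ₂ x)) x


/-- The standard form of a type-1 generalized complex structure with respect to a basis. -/
def StdForm (B : Basis (Fin 4) ℝ g) (lam : ℝ) (J : g →ₗ[ℝ] g)
    (R : Module.Dual ℝ g →ₗ[ℝ] g) (σ : g →ₗ[ℝ] Module.Dual ℝ g) : Prop :=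
  J (B 0) = lam • B 0 ∧ J (B 1) = lam • B 1 ∧ J (B 2) = B 3 ∧ J (B 3) = -B 2 ∧
  (∀ α : Module.Dual ℝ g, R α = α (B 0) • B 1 - α (B 1) • B 0) ∧
  (∀ u v : g, σ u v =
    (1 + lam ^ 2) * (B.coord 0 u * B.coord 1 v - B.coord 1 u * B.coord 0 v))

theorem aux_mk [FiniteDimensional ℝ g]
    (hdim : Module.finrank ℝ g = 4)
    (J : g →ₗ[ℝ] g) (R : Module.Dual ℝ g →ₗ[ℝ] g) (σ : g →ₗ[ℝ] Module.Dual ℝ g)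
    (h : IsGCS J R σ) (e f v : g) (lam : ℝ)
    (hind : ∀ x y : ℝ, x • e + y • f = 0 → x = 0 ∧ y = 0)
    (hR : ∀ α : Module.Dual ℝ g, R α = α e • f - α f • e)
    (he : J e = lam • e) (hf : J f = lam • f) (hv : J (J v) = -v) (hv0 : v ≠ 0) :
    ∃ B : Basis (Fin 4) ℝ g, StdForm B lam J R σ ∧ B 0 = e ∧ B 1 = f ∧ B 2 = v ∧ B 3 = J v := by
  have hli : LinearIndependent ℝ ![e, f, v, J v] := by
    rw [Fintype.linearIndependent_iff]
    intro c hc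
    simp only [Fin.sum_univ_four, Matrix.cons_val] at hc
    have h2 := congrArg (fun u => J (J u) + u) hc
    simp only [map_add, map_smul, he, hf, hv, map_neg, map_zero, add_zero] at h2
    have h3 : (c 0 * (lam ^ 2 + 1)) • e + (c 1 * (lam ^ 2 + 1)) • f = 0 := by
      rw [← h2]; module
    have hp : lam ^ 2 + 1 ≠ 0 := by positivity
    obtain ⟨h4, h5⟩ := hind _ _ h3
    have h0 : c 0 = 0 := by simpa [hp] using h4
    have h1 : c 1 = 0 := by simpa [hp] using h5
    simp only [h0, h1, zero_smul, zero_add] at hc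
    have h6 := congrArg J hc
    simp only [map_add, map_smul, hv, map_zero] at h6
    have h7 : (c 2 ^ 2 + c 3 ^ 2) • v = 0 := by
      have : (c 2 ^ 2 + c 3 ^ 2) • v = c 2 • (c 2 • v + c 3 • J v) - c 3 • (c 2 • J v + c 3 • -v) := by
        module
      rw [this, hc, h6]; simp
    have h8 : c 2 ^ 2 + c 3 ^ 2 = 0 := by simpa [hv0] using h7
    have h9 : c 2 = 0 := by nlinarith [sq_nonneg (c 2), sq_nonneg (c 3)]
    have h10 : c 3 = 0 := by nlinarith [sq_nonneg (c 2), sq_nonneg (c 3)]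
    intro i; fin_cases i <;> assumption
  let B := basisOfLinearIndependentOfCardEqFinrank hli (by simp [hdim])
  have hB : ⇑B = ![e, f, v, J v] := coe_basisOfLinearIndependentOfCardEqFinrank hli (by simp [hdim])
  have b0 : B 0 = e := by simp [hB]
  have b1 : B 1 = f := by simp [hB]
  have b2 : B 2 = v := by simp [hB]
  have b3 : B 3 = J v := by simp [hB]
  refine ⟨B, ⟨by rw [b0, he], by rw [b1, hf], by rw [b2, b3], by rw [b2, b3, hv],
    by rw [b0, b1]; exact hR, ?_⟩, b0, b1, b2, b3⟩
  have hself : ∀ u, σ u u = 0 := fun u => by linarith [h.skewσ u u]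
  have hc0 : ∀ u, J (J u) + R (σ u) = -u := fun u => by
    simpa using LinearMap.congr_fun h.c0a u
  have hef : σ e f = 1 + lam ^ 2 := by
    have := hc0 e
    rw [he, map_smul, he, hR, hself] at this
    have h2 : (lam ^ 2 + 1 - σ e f) • e + (0 : ℝ) • f = 0 := by
      have h3 := congrArg (fun u => u + e) this
      simp only [neg_add_cancel] at h3
      rw [← h3]; module
    linarith [(hind _ _ h2).1]
  have hz : ∀ u, J (J u) = -u → σ u e = 0 ∧ σ u f = 0 := by
    intro u hu
    have := hc0 u
    rw [hu, hR] at this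
    have h2 : (-σ u f) • e + (σ u e) • f = 0 := by
      have h3 := congrArg (fun w => w + u) this
      simp only [neg_add_cancel] at h3
      rw [← h3]; module
    have := hind _ _ h2
    exact ⟨this.2, by linarith [this.1]⟩
  obtain ⟨z1, z2⟩ := hz v hv
  obtain ⟨z3, z4⟩ := hz (J v) (by rw [hv, map_neg])
  have z5 : σ v (J v) = 0 := by
    have h1 : σ (J v) v = σ v (J v) := by
      simpa using LinearMap.congr_fun (LinearMap.congr_fun h.c0c v) v
    linarith [h.skewσ (J v) v]
  have z6 : σ (J v) v = 0 := by linarith [h.skewσ (J v) v]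
  have z7 : σ f e = -(1 + lam ^ 2) := by linarith [h.skewσ f e]
  have y1 : σ e v = 0 := by linarith [h.skewσ e v]
  have y2 : σ f v = 0 := by linarith [h.skewσ f v]
  have y3 : σ e (J v) = 0 := by linarith [h.skewσ e (J v)]
  have y4 : σ f (J v) = 0 := by linarith [h.skewσ f (J v)]
  intro u w
  have hu := B.sum_repr u
  have hw := B.sum_repr w
  simp only [Fin.sum_univ_four, b0, b1, b2, b3] at hu hw
  conv_lhs => rw [← hu, ← hw]
  simp only [map_add, map_smul, LinearMap.add_apply, LinearMap.smul_apply, smul_eq_mul, hself, hef,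
    z1, z2, z3, z4, z5, z6, z7, y1, y2, y3, y4, Basis.coord_apply]
  ring

theorem aux_exists [FiniteDimensional ℝ g]
    (hdim : Module.finrank ℝ g = 4)
    (J : g →ₗ[ℝ] g) (R : Module.Dual ℝ g →ₗ[ℝ] g) (σ : g →ₗ[ℝ] Module.Dual ℝ g)
    (h : IsGCS J R σ) (htype : Module.finrank ℝ (LinearMap.range R) = 2) :
    ∃ (B : Basis (Fin 4) ℝ g) (lam : ℝ), StdForm B lam J R σ := by
  have hne : ∃ α β : Module.Dual ℝ g, α (R β) = 1 := by
    by_contra! hcon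
    have hz : R = 0 := by
      ext β
      by_contra hb
      apply hb
      refine (Module.forall_dual_apply_eq_zero_iff ℝ (R β)).mp fun φ => ?_
      by_contra hφ
      exact hcon ((φ (R β))⁻¹ • φ) β (by simp [hφ])
    rw [hz, LinearMap.range_zero, finrank_bot] at htype
    omega
  obtain ⟨α, β, hab⟩ := hne
  have hself : ∀ α : Module.Dual ℝ g, α (R α) = 0 := fun α => by linarith [h.skewR α α]
  have hba : β (R α) = -1 := by rw [h.skewR, hab]
  have hind : ∀ x y : ℝ, x • R β + y • R α = 0 → x = 0 ∧ y = 0 := by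
    intro x y hxy
    have h1 := congrArg α hxy
    have h2 := congrArg β hxy
    simp [hself, hab, hba] at h1 h2
    exact ⟨h1, h2⟩
  have hli : LinearIndependent ℝ ![R β, R α] := LinearIndependent.pair_iff.mpr hind
  have hspan : Submodule.span ℝ (Set.range ![R β, R α]) = LinearMap.range R := by
    apply Submodule.eq_of_le_of_finrank_eq
    · rw [Submodule.span_le]
      rintro _ ⟨i, rfl⟩
      fin_cases i <;> simp
    · rw [finrank_span_eq_card hli, htype]; simp
  have hR : ∀ γ : Module.Dual ℝ g, R γ = γ (R β) • R α - γ (R α) • R β := by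
    intro γ
    have hm : R γ ∈ Submodule.span ℝ (Set.range ![R β, R α]) := by rw [hspan]; simp
    simp only [Matrix.range_cons, Matrix.range_empty, Set.union_empty, Set.singleton_union] at hm
    obtain ⟨x, y, hxy⟩ := Submodule.mem_span_pair.mp hm
    have h1 := congrArg α hxy
    have h2 := congrArg β hxy
    simp [hself, hab, hba] at h1 h2
    rw [← hxy, h.skewR γ α, h.skewR γ β, ← h1, ← h2]; module
  have hJ : ∀ γ : Module.Dual ℝ g, J (R γ) = γ (J (R β)) • R α - γ (J (R α)) • R β := by
    intro γ
    have := LinearMap.congr_fun h.c0b γ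
    simp only [LinearMap.comp_apply] at this
    rw [this, hR]; simp
  have k1 : α (J (R α)) = 0 := by
    have := congrArg α (hJ α)
    simp [hself, hab] at this
    linarith
  have k2 : β (J (R β)) = 0 := by
    have := congrArg β (hJ β)
    simp [hself, hba] at this
    linarith
  have k3 : β (J (R α)) = - α (J (R β)) := by
    have := congrArg β (hJ α)
    simp [hself, hba] at this
    linarith
  have hker : ∃ v : g, v ≠ 0 ∧ J (J v) = -v := by
    have hlt : LinearMap.ker (R ∘ₗ σ) ≠ ⊥ := by
      intro hk
      have h1 := LinearMap.finrank_range_add_finrank_ker (R ∘ₗ σ)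
      have h2 := Submodule.finrank_mono (LinearMap.range_comp_le_range σ R)
      rw [hk, finrank_bot] at h1
      omega
    obtain ⟨v, hv, hv0⟩ := Submodule.exists_mem_ne_zero_of_ne_bot hlt
    refine ⟨v, hv0, ?_⟩
    have := LinearMap.congr_fun h.c0a v
    rw [LinearMap.add_apply, LinearMap.mem_ker.mp hv] at this
    simpa using this
  obtain ⟨v, hv0, hv⟩ := hker
  obtain ⟨B, hB, -⟩ := aux_mk hdim J R σ h (R β) (R α) v (α (J (R β))) hind hR
    (by rw [hJ β, k2, k3, zero_smul, zero_sub, neg_smul, neg_neg, map_smul, hab, smul_eq_mul, mul_one]) (by rw [hJ α, k1]; module) hv hv0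
  exact ⟨B, _, hB⟩

theorem aux_change [FiniteDimensional ℝ g]
    (hdim : Module.finrank ℝ g = 4)
    (J : g →ₗ[ℝ] g) (R : Module.Dual ℝ g →ₗ[ℝ] g) (σ : g →ₗ[ℝ] Module.Dual ℝ g)
    (h : IsGCS J R σ) (B : Basis (Fin 4) ℝ g) (lam : ℝ) (hB : StdForm B lam J R σ)
    (a b c d x y : ℝ) (hdet : a * d - b * c = 1) (hxy : x ^ 2 + y ^ 2 ≠ 0) :
    ∃ B' : Basis (Fin 4) ℝ g, StdForm B' lam J R σ ∧ B' 0 = a • B 0 + b • B 1 ∧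
      B' 1 = c • B 0 + d • B 1 ∧ B' 2 = x • B 2 + y • B 3 ∧ B' 3 = x • B 3 - y • B 2 := by
  obtain ⟨h0, h1, h2, h3, h4, -⟩ := hB
  have q1 : ∀ s t : ℝ, s • (a • B 0 + b • B 1) + t • (c • B 0 + d • B 1) = 0 → s = 0 ∧ t = 0 := by
    intro s t hst
    have k0 := congrArg (B.coord 0) hst
    have k1 := congrArg (B.coord 1) hst
    simp [Finsupp.single_apply] at k0 k1
    exact ⟨by linear_combination d * k0 - c * k1 - s * hdet,
      by linear_combination a * k1 - b * k0 - t * hdet⟩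
  have q2 : ∀ α : Module.Dual ℝ g, R α = α (a • B 0 + b • B 1) • (c • B 0 + d • B 1) - α (c • B 0 + d • B 1) • (a • B 0 + b • B 1) := by
    intro α
    rw [h4 α]
    simp only [map_add, map_smul, smul_eq_mul]
    have : ∀ z : g, z = (a * d - b * c) • z := fun z => by rw [hdet, one_smul]
    rw [this (α (B 0) • B 1 - α (B 1) • B 0)]
    module
  have q3 : J (a • B 0 + b • B 1) = lam • (a • B 0 + b • B 1) := by
    simp [h0, h1]; module
  have q4 : J (c • B 0 + d • B 1) = lam • (c • B 0 + d • B 1) := by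
    simp [h0, h1]; module
  have q5 : J (J (x • B 2 + y • B 3)) = -(x • B 2 + y • B 3) := by
    simp [h2, h3]; module
  have q6 : x • B 2 + y • B 3 ≠ 0 := by
    intro hz
    have k0 := congrArg (B.coord 2) hz
    have k1 := congrArg (B.coord 3) hz
    simp [Finsupp.single_apply] at k0 k1
    exact hxy (by rw [k0, k1]; ring)
  obtain ⟨B', hB', e0, e1, e2, e3⟩ := aux_mk hdim J R σ h (a • B 0 + b • B 1) (c • B 0 + d • B 1)
    (x • B 2 + y • B 3) lam q1 q2 q3 q4 q5 q6
  refine ⟨B', hB', e0, e1, e2, ?_⟩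
  rw [e3, map_add, map_smul, map_smul, h2, h3]; module

theorem aux_const [FiniteDimensional ℝ g]
    (hunim : ∀ u : g, LinearMap.trace ℝ g (LieAlgebra.ad ℝ g u : g →ₗ[ℝ] g) = 0)
    (J : g →ₗ[ℝ] g) (R : Module.Dual ℝ g →ₗ[ℝ] g) (σ : g →ₗ[ℝ] Module.Dual ℝ g)
    (h : IsGCS J R σ) (B : Basis (Fin 4) ℝ g) (lam : ℝ) (hB : StdForm B lam J R σ) :
    ∃ a₁ a₂ w₁ w₂ s t q s' t' q' b₁ b₂ : ℝ,
      ⁅B 0, B 1⁆ = a₁ • B 0 + a₂ • B 1 ∧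
      ⁅B 0, B 2⁆ = s • B 0 + t • B 1 - (a₂ / 2) • B 2 + w₁ • B 3 ∧
      ⁅B 0, B 3⁆ = s' • B 0 + t' • B 1 - w₁ • B 2 - (a₂ / 2) • B 3 ∧
      ⁅B 1, B 2⁆ = q • B 0 - s • B 1 + (a₁ / 2) • B 2 + w₂ • B 3 ∧
      ⁅B 1, B 3⁆ = q' • B 0 - s' • B 1 - w₂ • B 2 + (a₁ / 2) • B 3 ∧
      ⁅B 2, B 3⁆ = b₁ • B 0 + b₂ • B 1 := by
  obtain ⟨h0, h1, h2, h3, h4, -⟩ := hB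
  have tr : ∀ u : g, B.repr ⁅u, B 0⁆ 0 + B.repr ⁅u, B 1⁆ 1 + B.repr ⁅u, B 2⁆ 2
      + B.repr ⁅u, B 3⁆ 3 = 0 := by
    intro u
    have := hunim u
    rw [LinearMap.trace_eq_matrix_trace ℝ B, Matrix.trace, Fin.sum_univ_four] at this
    simpa [LinearMap.toMatrix_apply] using this
  have R0 : R (B.coord 0) = B 1 := by rw [h4]; simp
  have R1 : R (B.coord 1) = -B 0 := by rw [h4]; simp
  have R2 : R (B.coord 2) = 0 := by rw [h4]; simp
  have R3 : R (B.coord 3) = 0 := by rw [h4]; simp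
  have sk : ∀ i j : Fin 4, ∀ k, B.repr ⁅B i, B j⁆ k = - B.repr ⁅B j, B i⁆ k := by
    intro i j k
    rw [← lie_skew, map_neg, Finsupp.neg_apply]
  have hJs : ∀ u, B.repr (J u) 2 = - B.repr u 3 ∧ B.repr (J u) 3 = B.repr u 2 ∧
      B.repr (J u) 0 = lam * B.repr u 0 ∧ B.repr (J u) 1 = lam * B.repr u 1 := by
    intro u
    have hu := B.sum_repr u
    simp only [Fin.sum_univ_four] at hu
    have : J u = B.repr u 0 • lam • B 0 + B.repr u 1 • lam • B 1 + B.repr u 2 • B 3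
        + B.repr u 3 • -B 2 := by
      conv_lhs => rw [← hu]
      simp [h0, h1, h2, h3]
    rw [this]
    simp [Finsupp.single_apply, mul_comm]
  have hJ2 := fun u => (hJs u).1
  have hJ3 := fun u => (hJs u).2.1
  have hJ0 := fun u => (hJs u).2.2.1
  have hJ1 := fun u => (hJs u).2.2.2
  have c012 : B.repr ⁅B 0, B 1⁆ 2 = 0 := by
    have := h.c1 (B.coord 0) (B.coord 1) (B.coord 2)
    simpa [R0, R1, R2, sk 1 0] using this
  have c013 : B.repr ⁅B 0, B 1⁆ 3 = 0 := by
    have := h.c1 (B.coord 0) (B.coord 1) (B.coord 3)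
    simpa [R0, R1, R3, sk 1 0] using this
  have c2 := fun (α β : Module.Dual ℝ g) (u : g) => LinearMap.congr_fun (h.c2 α β) u
  have p1 := c2 (B.coord 0) (B.coord 2) (B 2)
  have p2 := c2 (B.coord 0) (B.coord 2) (B 3)
  have p3 := c2 (B.coord 1) (B.coord 2) (B 2)
  have p4 := c2 (B.coord 1) (B.coord 2) (B 3)
  have p5 := c2 (B.coord 0) (B.coord 1) (B 2)
  have p6 := c2 (B.coord 0) (B.coord 1) (B 3)
  simp [coad, R0, R1, R2, hJ0, hJ1, hJ2, hJ3, h2, h3] at p1 p2 p3 p4 p5 p6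
  rw [sk 2 1] at p2 p6
  rw [sk 2 0] at p4 p6
  have t0 := tr (B 0)
  have t1 := tr (B 1)
  have t2 := tr (B 2)
  have t3 := tr (B 3)
  rw [sk 2 0, sk 2 1] at t2
  rw [sk 3 0, sk 3 1, sk 3 2] at t3
  rw [sk 1 0] at t1
  simp only [lie_self, map_zero, Finsupp.coe_zero, Pi.zero_apply] at t0 t1 t2 t3
  have hp : lam ^ 2 + 1 ≠ 0 := by positivity
  have r1 : B.repr ⁅B 0, B 2⁆ 0 + B.repr ⁅B 1, B 2⁆ 1 = 0 := by
    have : (lam ^ 2 + 1) * (B.repr ⁅B 0, B 2⁆ 0 + B.repr ⁅B 1, B 2⁆ 1) = 0 := by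
      linear_combination p6 + lam * p5
    simpa [hp] using this
  have r2 : B.repr ⁅B 0, B 3⁆ 0 + B.repr ⁅B 1, B 3⁆ 1 = 0 := by
    have : (lam ^ 2 + 1) * (B.repr ⁅B 0, B 3⁆ 0 + B.repr ⁅B 1, B 3⁆ 1) = 0 := by
      linear_combination -p5 + lam * p6
    simpa [hp] using this
  have ex : ∀ u : g, u = B.repr u 0 • B 0 + B.repr u 1 • B 1 + B.repr u 2 • B 2 + B.repr u 3 • B 3 :=
    fun u => by
      conv_lhs => rw [← B.sum_repr u, Fin.sum_univ_four]
  refine ⟨B.repr ⁅B 0, B 1⁆ 0, B.repr ⁅B 0, B 1⁆ 1, B.repr ⁅B 0, B 2⁆ 3, B.repr ⁅B 1, B 2⁆ 3,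
    B.repr ⁅B 0, B 2⁆ 0, B.repr ⁅B 0, B 2⁆ 1, B.repr ⁅B 1, B 2⁆ 0,
    B.repr ⁅B 0, B 3⁆ 0, B.repr ⁅B 0, B 3⁆ 1, B.repr ⁅B 1, B 3⁆ 0,
    B.repr ⁅B 2, B 3⁆ 0, B.repr ⁅B 2, B 3⁆ 1, ?_, ?_, ?_, ?_, ?_, ?_⟩
  all_goals
    apply B.repr.injective
    ext i
    fin_cases i <;> simp [Finsupp.single_apply] <;> linarith

set_option maxHeartbeats 2000000 in
theorem aux_jac [FiniteDimensional ℝ g] (B : Basis (Fin 4) ℝ g)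
    (a₁ a₂ w₁ w₂ s t q s' t' q' b₁ b₂ : ℝ)
    (h01 : ⁅B 0, B 1⁆ = a₁ • B 0 + a₂ • B 1)
    (h02 : ⁅B 0, B 2⁆ = s • B 0 + t • B 1 - (a₂ / 2) • B 2 + w₁ • B 3)
    (h03 : ⁅B 0, B 3⁆ = s' • B 0 + t' • B 1 - w₁ • B 2 - (a₂ / 2) • B 3)
    (h12 : ⁅B 1, B 2⁆ = q • B 0 - s • B 1 + (a₁ / 2) • B 2 + w₂ • B 3)
    (h13 : ⁅B 1, B 3⁆ = q' • B 0 - s' • B 1 - w₂ • B 2 + (a₁ / 2) • B 3)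
    (h23 : ⁅B 2, B 3⁆ = b₁ • B 0 + b₂ • B 1) :
    (-(q * a₂) - s * a₁ - 2 * w₁ * q' + 2 * w₂ * s' = 0) ∧
    (s * a₂ - a₁ * t + 2 * w₁ * s' + 2 * w₂ * t' = 0) ∧
    (a₁ * w₁ + a₂ * w₂ = 0) ∧
    (2 * q * w₁ - 2 * s * w₂ - a₁ * s' - a₂ * q' = 0) ∧
    (-(2 * s * w₁) - a₁ * t' + a₂ * s' - 2 * t * w₂ = 0) ∧
    (q * t' + a₁ * b₂ + a₂ * b₁ - t * q' = 0) ∧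
    (-(s * t') + a₂ * b₂ + t * s' = 0) ∧
    (-(q * s') + s * q' - a₁ * b₁ = 0) := by
  have h10 : ⁅B 1, B 0⁆ = -(a₁ • B 0 + a₂ • B 1) := by rw [← lie_skew, h01]
  have h20 : ⁅B 2, B 0⁆ = -(s • B 0 + t • B 1 - (a₂ / 2) • B 2 + w₁ • B 3) := by rw [← lie_skew, h02]
  have h30 : ⁅B 3, B 0⁆ = -(s' • B 0 + t' • B 1 - w₁ • B 2 - (a₂ / 2) • B 3) := by
    rw [← lie_skew, h03]
  have h21 : ⁅B 2, B 1⁆ = -(q • B 0 - s • B 1 + (a₁ / 2) • B 2 + w₂ • B 3) := by rw [← lie_skew, h12]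
  have h31 : ⁅B 3, B 1⁆ = -(q' • B 0 - s' • B 1 - w₂ • B 2 + (a₁ / 2) • B 3) := by
    rw [← lie_skew, h13]
  have h32 : ⁅B 3, B 2⁆ = -(b₁ • B 0 + b₂ • B 1) := by rw [← lie_skew, h23]
  have j1 := lie_jacobi (B 0) (B 1) (B 2)
  have j2 := lie_jacobi (B 0) (B 1) (B 3)
  have j3 := lie_jacobi (B 0) (B 2) (B 3)
  have j4 := lie_jacobi (B 1) (B 2) (B 3)
  simp only [h01, h02, h03, h12, h13, h23, h10, h20, h30, h21, h31, h32, lie_add, lie_smul, lie_sub,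
    lie_neg, lie_self] at j1 j2 j3 j4
  have f00 : B.repr (B 0) 0 = 1 := by simp
  have f01 : B.repr (B 0) 1 = 0 := by simp
  have f02 : B.repr (B 0) 2 = 0 := by simp
  have f03 : B.repr (B 0) 3 = 0 := by simp
  have f10 : B.repr (B 1) 0 = 0 := by simp
  have f11 : B.repr (B 1) 1 = 1 := by simp
  have f12 : B.repr (B 1) 2 = 0 := by simp
  have f13 : B.repr (B 1) 3 = 0 := by simp
  have f20 : B.repr (B 2) 0 = 0 := by simp
  have f21 : B.repr (B 2) 1 = 0 := by simp
  have f22 : B.repr (B 2) 2 = 1 := by simp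
  have f23 : B.repr (B 2) 3 = 0 := by simp
  have f30 : B.repr (B 3) 0 = 0 := by simp
  have f31 : B.repr (B 3) 1 = 0 := by simp
  have f32 : B.repr (B 3) 2 = 0 := by simp
  have f33 : B.repr (B 3) 3 = 1 := by simp
  have j10 := congrArg (fun u => B.repr u 0) j1
  have j11 := congrArg (fun u => B.repr u 1) j1
  have j12 := congrArg (fun u => B.repr u 2) j1
  have j13 := congrArg (fun u => B.repr u 3) j1
  have j20 := congrArg (fun u => B.repr u 0) j2
  have j21 := congrArg (fun u => B.repr u 1) j2
  have j22 := congrArg (fun u => B.repr u 2) j2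
  have j23 := congrArg (fun u => B.repr u 3) j2
  have j30 := congrArg (fun u => B.repr u 0) j3
  have j31 := congrArg (fun u => B.repr u 1) j3
  have j32 := congrArg (fun u => B.repr u 2) j3
  have j33 := congrArg (fun u => B.repr u 3) j3
  have j40 := congrArg (fun u => B.repr u 0) j4
  have j41 := congrArg (fun u => B.repr u 1) j4
  have j42 := congrArg (fun u => B.repr u 2) j4
  have j43 := congrArg (fun u => B.repr u 3) j4
  clear j1 j2 j3 j4
  simp only [map_add, map_sub, map_neg, map_smul, map_zero, Finsupp.add_apply, Finsupp.sub_apply, Finsupp.neg_apply,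
    Finsupp.smul_apply, Finsupp.zero_apply, smul_eq_mul,
    f00, f01, f02, f03, f10, f11, f12, f13, f20, f21, f22, f23, f30, f31, f32, f33] at j10 j11 j12 j13 j20 j21 j22 j23 j30 j31 j32 j33 j40 j41 j42 j43
  ring_nf at j10 j11 j12 j13 j20 j21 j22 j23 j30 j31 j32 j33 j40 j41 j42 j43
  refine ⟨?_, ?_, ?_, ?_, ?_, ?_, ?_, ?_⟩ <;> linarith

theorem aux_lin (s t q s' t' q' : ℝ) (h1 : q * t' = t * q') (h2 : s * t' = t * s')
    (h3 : q * s' = s * q') :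
    ∃ x y : ℝ, x ^ 2 + y ^ 2 ≠ 0 ∧ x * s + y * s' = 0 ∧ x * t + y * t' = 0 ∧ x * q + y * q' = 0 := by
  have key : ∀ x y : ℝ, y ≠ 0 → x ^ 2 + y ^ 2 ≠ 0 := fun x y hy => by positivity
  by_cases hs : s = 0
  · by_cases ht : t = 0
    · by_cases hq : q = 0
      · exact ⟨1, 0, by norm_num, by simp [hs], by simp [ht], by simp [hq]⟩
      · exact ⟨q', -q, key _ _ (neg_ne_zero.mpr hq), by linarith, by linarith, by ring⟩
    · exact ⟨t', -t, key _ _ (neg_ne_zero.mpr ht), by linarith, by ring, by linarith⟩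
  · exact ⟨s', -s, key _ _ (neg_ne_zero.mpr hs), by ring, by linarith, by linarith⟩

theorem aux_scale (D : ℝ) : ∃ k : ℝ, k ≠ 0 ∧ (|k ^ 2 * D| = 0 ∨ |k ^ 2 * D| = 1) := by
  by_cases hD : D = 0
  · exact ⟨1, one_ne_zero, Or.inl (by simp [hD])⟩
  · have hp : 0 < |D| := abs_pos.mpr hD
    refine ⟨(Real.sqrt |D|)⁻¹, by positivity, Or.inr ?_⟩
    rw [abs_mul, abs_of_nonneg (by positivity), inv_pow, Real.sq_sqrt hp.le,
      inv_mul_cancel₀ hp.ne']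

theorem aux_coords (B : Basis (Fin 4) ℝ g) {a b c d a' b' c' d' : ℝ}
    (h : a • B 0 + b • B 1 + c • B 2 + d • B 3 = a' • B 0 + b' • B 1 + c' • B 2 + d' • B 3) :
    a = a' ∧ b = b' ∧ c = c' ∧ d = d' := by
  refine ⟨?_, ?_, ?_, ?_⟩
  · simpa using congrArg (fun u => B.repr u 0) h
  · simpa using congrArg (fun u => B.repr u 1) h
  · simpa using congrArg (fun u => B.repr u 2) h
  · simpa using congrArg (fun u => B.repr u 3) h

/-- classification in the unimodular case (Theorem 2.1). -/
theorem gcs_type1_unimodular_classification [FiniteDimensional ℝ g]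
    (hdim : Module.finrank ℝ g = 4)
    (hunim : ∀ u : g, LinearMap.trace ℝ g (LieAlgebra.ad ℝ g u : g →ₗ[ℝ] g) = 0)
    (J : g →ₗ[ℝ] g) (R : Module.Dual ℝ g →ₗ[ℝ] g) (σ : g →ₗ[ℝ] Module.Dual ℝ g)
    (h : IsGCS J R σ) (htype : Module.finrank ℝ (LinearMap.range R) = 2) :
    ∃ (B : Basis (Fin 4) ℝ g) (lam : ℝ), StdForm B lam J R σ ∧
      ((∃ y q₁ q₂ : ℝ,
          ⁅B 0, B 1⁆ = B 0 ∧ ⁅B 0, B 2⁆ = 0 ∧ ⁅B 0, B 3⁆ = 0 ∧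
          ⁅B 1, B 2⁆ = (1/2 : ℝ) • B 2 - y • B 3 - q₁ • B 0 ∧
          ⁅B 1, B 3⁆ = y • B 2 + (1/2 : ℝ) • B 3 - q₂ • B 0 ∧
          ⁅B 2, B 3⁆ = 0) ∨
       (∃ b₁ b₂ y q₁ q₂ : ℝ,
          ⁅B 0, B 1⁆ = 0 ∧ ⁅B 0, B 2⁆ = 0 ∧ ⁅B 0, B 3⁆ = 0 ∧
          ⁅B 1, B 2⁆ = -(y • B 3) - q₁ • B 0 ∧
          ⁅B 1, B 3⁆ = y • B 2 - q₂ • B 0 ∧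
          ⁅B 2, B 3⁆ = b₁ • B 0 + b₂ • B 1) ∨
       (∃ b₁ b₂ p q r : ℝ, (|p ^ 2 + q * r| = 0 ∨ |p ^ 2 + q * r| = 1) ∧
          ⁅B 0, B 1⁆ = 0 ∧ ⁅B 0, B 2⁆ = 0 ∧
          ⁅B 3, B 0⁆ = p • B 0 + r • B 1 ∧
          ⁅B 1, B 2⁆ = 0 ∧
          ⁅B 3, B 1⁆ = q • B 0 - p • B 1 ∧
          ⁅B 2, B 3⁆ = b₁ • B 0 + b₂ • B 1)) := by
  obtain ⟨B, lam, hB⟩ := aux_exists hdim J R σ h htype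
  obtain ⟨a₁, a₂, w₁, w₂, s, t, q, s', t', q', b₁, b₂, h01, h02, h03, h12, h13, h23⟩ :=
    aux_const hunim J R σ h B lam hB
  by_cases ha : a₁ ^ 2 + a₂ ^ 2 = 0
  · have ha1 : a₁ = 0 := by nlinarith [sq_nonneg a₁, sq_nonneg a₂]
    have ha2 : a₂ = 0 := by nlinarith [sq_nonneg a₁, sq_nonneg a₂]
    subst ha1 ha2
    by_cases hw : w₁ ^ 2 + w₂ ^ 2 = 0
    · have hw1 : w₁ = 0 := by nlinarith [sq_nonneg w₁, sq_nonneg w₂]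
      have hw2 : w₂ = 0 := by nlinarith [sq_nonneg w₁, sq_nonneg w₂]
      subst hw1 hw2
      obtain ⟨-, -, -, -, -, k1, k2, k3⟩ := aux_jac B _ _ _ _ _ _ _ _ _ _ _ _ h01 h02 h03 h12 h13 h23
      obtain ⟨x, y, hxy, l1, l2, l3⟩ := aux_lin s t q s' t' q' (by linarith) (by linarith)
        (by linarith)
      obtain ⟨k, hk, hkD⟩ := aux_scale ((x * s' - y * s) ^ 2 + (x * q' - y * q) * (x * t' - y * t))
      obtain ⟨B', hB', e0, e1, e2, e3⟩ := aux_change hdim J R σ h B lam hB 1 0 0 1 (k * x) (k * y)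
        (by ring) (by
          have : (k * x) ^ 2 + (k * y) ^ 2 = k ^ 2 * (x ^ 2 + y ^ 2) := by ring
          rw [this]; exact mul_ne_zero (pow_ne_zero 2 hk) hxy)
      have h20 : ⁅B 2, B 0⁆ = -(s • B 0 + t • B 1) := by rw [← lie_skew, h02]; simp
      have h30 : ⁅B 3, B 0⁆ = -(s' • B 0 + t' • B 1) := by rw [← lie_skew, h03]; simp
      have h21 : ⁅B 2, B 1⁆ = -(q • B 0 - s • B 1) := by rw [← lie_skew, h12]; simp
      have h31 : ⁅B 3, B 1⁆ = -(q' • B 0 - s' • B 1) := by rw [← lie_skew, h13]; simp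
      have h32 : ⁅B 3, B 2⁆ = -(b₁ • B 0 + b₂ • B 1) := by rw [← lie_skew, h23]
      refine ⟨B', lam, hB', Or.inr (Or.inr ⟨k ^ 2 * (x ^ 2 + y ^ 2) * b₁,
        k ^ 2 * (x ^ 2 + y ^ 2) * b₂, -(k * (x * s' - y * s)), -(k * (x * q' - y * q)),
        -(k * (x * t' - y * t)), ?_, ?_, ?_, ?_, ?_, ?_, ?_⟩)⟩
      · convert hkD using 3 <;> ring
      · simp only [e0, e1, zero_smul, one_smul, add_zero, zero_add, h01]
      · simp only [e0, e2, zero_smul, one_smul, add_zero, lie_add, lie_smul, h02, h03]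
        trans (k * (x * s + y * s')) • B 0 + (k * (x * t + y * t')) • B 1
        · module
        · rw [l1, l2]; simp
      · simp only [e0, e1, e3, zero_smul, one_smul, add_zero, zero_add, sub_lie, smul_lie, h20, h30]
        module
      · simp only [e1, e2, zero_smul, one_smul, zero_add, lie_add, lie_smul, h12, h13]
        trans (k * (x * q + y * q')) • B 0 - (k * (x * s + y * s')) • B 1
        · module
        · rw [l1, l3]; simp
      · simp only [e0, e1, e3, zero_smul, one_smul, add_zero, zero_add, sub_lie, smul_lie, h21, h31]
        module
      · simp only [e0, e1, e2, e3, zero_smul, one_smul, add_zero, zero_add, add_lie, lie_sub,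
          smul_lie, lie_smul, h23, h32, lie_self]
        module
    · obtain ⟨B', hB', e0, e1, e2, e3⟩ := aux_change hdim J R σ h B lam hB w₂ (-w₁)
        (w₁ / (w₁ ^ 2 + w₂ ^ 2)) (w₂ / (w₁ ^ 2 + w₂ ^ 2)) 1 0 (by field_simp; ring) (by norm_num)
      obtain ⟨c₁, c₂, v₁, v₂, S, T, Q, S', T', Q', d₁, d₂, g01, g02, g03, g12, g13, g23⟩ :=
        aux_const hunim J R σ h B' lam hB'
      have h10 : ⁅B 1, B 0⁆ = 0 := by rw [← lie_skew, h01]; simp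
      have g01' : ⁅B' 0, B' 1⁆ = 0 := by
        simp [e0, e1, h01, h10]
      obtain ⟨hc1, hc2, -, -⟩ := aux_coords B' (a := c₁) (b := c₂) (c := 0) (d := 0)
        (a' := 0) (b' := 0) (c' := 0) (d' := 0) (by rw [g01'] at g01; simp [← g01])
      subst hc1 hc2
      have hv1 : v₁ = 0 := by
        have := congrArg (fun u => B.repr u 3) g02
        simp [e0, e1, e2, e3, h02, h12] at this
        linarith
      have hv2 : v₂ = 1 := by
        have := congrArg (fun u => B.repr u 3) g12
        simp [e0, e1, e2, e3, h02, h12] at this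
        rw [← this]
        field_simp
      subst hv1 hv2
      obtain ⟨k1, k2, -, k4, k5, -, -, -⟩ :=
        aux_jac B' _ _ _ _ _ _ _ _ _ _ _ _ g01 g02 g03 g12 g13 g23
      have z1 : S = 0 := by linarith
      have z2 : T = 0 := by linarith
      have z3 : S' = 0 := by linarith
      have z4 : T' = 0 := by linarith
      subst z1 z2 z3 z4
      refine ⟨B', lam, hB', Or.inr (Or.inl ⟨d₁, d₂, -1, -Q, -Q', g01', ?_, ?_, ?_, ?_, g23⟩)⟩
      · rw [g02]; module
      · rw [g03]; module
      · rw [g12]; module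
      · rw [g13]; module
  · obtain ⟨B', hB', e0, e1, e2, e3⟩ := aux_change hdim J R σ h B lam hB a₁ a₂
      (-a₂ / (a₁ ^ 2 + a₂ ^ 2)) (a₁ / (a₁ ^ 2 + a₂ ^ 2)) 1 0 (by field_simp; ring) (by norm_num)
    obtain ⟨c₁, c₂, v₁, v₂, S, T, Q, S', T', Q', d₁, d₂, g01, g02, g03, g12, g13, g23⟩ :=
      aux_const hunim J R σ h B' lam hB'
    have h10 : ⁅B 1, B 0⁆ = -(a₁ • B 0 + a₂ • B 1) := by rw [← lie_skew, h01]
    have g01' : ⁅B' 0, B' 1⁆ = B' 0 := by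
      have hone : (a₁ * (a₁ / (a₁ ^ 2 + a₂ ^ 2)) - a₂ * (-a₂ / (a₁ ^ 2 + a₂ ^ 2))) = 1 := by
        field_simp; ring
      have : ⁅B' 0, B' 1⁆ = (a₁ * (a₁ / (a₁ ^ 2 + a₂ ^ 2)) - a₂ * (-a₂ / (a₁ ^ 2 + a₂ ^ 2))) • B' 0 := by
        simp only [e0, e1, add_lie, lie_add, smul_lie, lie_smul, lie_self, h01, h10]
        module
      rw [this, hone, one_smul]
    obtain ⟨hc1, hc2, -, -⟩ := aux_coords B' (a := c₁) (b := c₂) (c := 0) (d := 0)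
      (a' := 1) (b' := 0) (c' := 0) (d' := 0) (by rw [g01'] at g01; simp [← g01])
    subst hc1 hc2
    obtain ⟨k1, k2, k3, k4, k5, k6, k7, k8⟩ :=
      aux_jac B' _ _ _ _ _ _ _ _ _ _ _ _ g01 g02 g03 g12 g13 g23
    have z0 : v₁ = 0 := by linarith
    subst z0
    have hp : 1 + 4 * v₂ ^ 2 ≠ 0 := by positivity
    have z1 : S = 0 := by
      have : (1 + 4 * v₂ ^ 2) * S = 0 := by linear_combination -k1 - 2 * v₂ * k4
      simpa [hp] using this
    have z2 : T = 0 := by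
      have : (1 + 4 * v₂ ^ 2) * T = 0 := by linear_combination -k2 - 2 * v₂ * k5
      simpa [hp] using this
    subst z1 z2
    have z3 : S' = 0 := by linarith
    have z4 : T' = 0 := by linarith
    subst z3 z4
    have z5 : d₁ = 0 := by linarith
    have z6 : d₂ = 0 := by linarith
    subst z5 z6
    refine ⟨B', lam, hB', Or.inl ⟨-v₂, -Q, -Q', g01', ?_, ?_, ?_, ?_, ?_⟩⟩
    · rw [g02]; module
    · rw [g03]; module
    · rw [g12]; module
    · rw [g13]; module
    · rw [g23]; module
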